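/- Let S be a finite monoid and A a finite set with at least two elements. The lattice of all S-preclones on A (ordered by inclusion, with least element SJ_A and greatest element SOp(A)) is atomic and coatomic: every S-preclone F with SJ_A ⊊ F contains an S-preclone that is minimal among the S-preclones properly containing SJ_A, and every S-preclone F with F ⊊ SOp(A) is contained in an S-preclone that is maximal among the S-preclones properly contained in SOp(A). -/

import Mathlib

namespace SPreclone

/-- An `S`-operation on `A`: an `(n+1)`-ary operation together with a signum
assigning an element of `S` to each argument. -/
structure SOp (S A : Type*) where
  n : ℕ
  fn : (Fin (n + 1) → A) → A
  sgn : Fin (n + 1) → S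

/-- An `S`-relation on `A`: a family of `(m+1)`-ary relations indexed by `S`. -/
structure SRel (S A : Type*) where
  m : ℕ
  rel : S → Set (Fin (m + 1) → A)

section

variable {S A : Type*} [Monoid S]

/-- `f` S-preserves `ρ`. -/
def SPreserves (f : SOp S A) (ρ : SRel S A) : Prop :=
  ∀ s : S, ∀ r : Fin (f.n + 1) → (Fin (ρ.m + 1) → A),
    (∀ i, r i ∈ ρ.rel (f.sgn i * s)) →
    (fun j => f.fn fun i => r i j) ∈ ρ.rel s

/-- `S`-polymorphisms of a set of `S`-relations. -/
def SPol (Q : Set (SRel S A)) : Set (SOp S A) := { f | ∀ ρ ∈ Q, SPreserves f ρ }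

/-- Invariant `S`-relations of a set of `S`-operations. -/
def SInv (F : Set (SOp S A)) : Set (SRel S A) := { ρ | ∀ f ∈ F, SPreserves f ρ }

/-- The identity operation, with signum `(e)`. -/
def idOp (S A : Type*) [Monoid S] : SOp S A := ⟨0, fun x => x 0, fun _ => 1⟩

/-- Cyclic shift `ζ` of the arguments (and the signa). -/
def cycOp (f : SOp S A) : SOp S A :=
  ⟨f.n, fun x => f.fn fun j => x (j + 1), fun i => f.sgn (i - 1)⟩

/-- Transposition `τ` of the first two arguments (and their signa). -/
def swapOp (f : SOp S A) : SOp S A :=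
  ⟨f.n, fun x => f.fn fun j => x (Equiv.swap 0 1 j), fun i => f.sgn (Equiv.swap 0 1 i)⟩

/-- `∇^s`: adding a fictitious first argument with signum `s`. -/
def nablaOp (s : S) (f : SOp S A) : SOp S A :=
  ⟨f.n + 1, fun x => f.fn fun j => x j.succ, Fin.cases (motive := fun _ => S) s f.sgn⟩

open Classical in
/-- `Δ`: identification of the first two arguments when they have the same signum
(otherwise, and for unary operations, `Δ f := f`). -/
noncomputable def deltaOp (f : SOp S A) : SOp S A :=
  match f with
  | ⟨0, fn, sgn⟩ => ⟨0, fn, sgn⟩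
  | ⟨m + 1, fn, sgn⟩ =>
    if sgn 0 = sgn 1 then
      ⟨m, fun x => fn fun j => x ⟨j.val - 1, by have := j.isLt; omega⟩,
        fun i => sgn i.succ⟩
    else ⟨m + 1, fn, sgn⟩

/-- Composition `(f ∘ g)(x₁,…,x_m,x_{m+1},…,x_{m+n-1}) = f(g(x₁,…,x_m),x_{m+1},…,x_{m+n-1})`,
with signum `(s'₁s₁, …, s'_m s₁, s₂, …, s_n)`. -/
def compOp (f g : SOp S A) : SOp S A :=
  ⟨g.n + f.n,
   fun x => f.fn fun k => Fin.cases (motive := fun _ => A)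
     (g.fn fun i => x ⟨i.val, by have := i.isLt; omega⟩)
     (fun j => x ⟨g.n + 1 + j.val, by have := j.isLt; omega⟩) k,
   fun i =>
     if h : i.val < g.n + 1 then g.sgn ⟨i.val, h⟩ * f.sgn 0
     else f.sgn ⟨i.val - g.n, by have := i.isLt; omega⟩⟩

/-- A set of `S`-operations is an `S`-preclone if it contains the identity and is closed
under `ζ`, `τ`, `∇^s`, `Δ` and composition. -/
def IsSPreclone (F : Set (SOp S A)) : Prop :=
  idOp S A ∈ F ∧
  (∀ f ∈ F, cycOp f ∈ F) ∧
  (∀ f ∈ F, swapOp f ∈ F) ∧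
  (∀ (s : S), ∀ f ∈ F, nablaOp s f ∈ F) ∧
  (∀ f ∈ F, deltaOp f ∈ F) ∧
  (∀ f ∈ F, ∀ g ∈ F, compOp f g ∈ F)

/-- The `S`-preclone generated by `F` (the least `S`-preclone containing `F`). -/
def SSg (F : Set (SOp S A)) : Set (SOp S A) := ⋂₀ { G | IsSPreclone G ∧ F ⊆ G }

/-- `δ^S := (Δ_A)_{s ∈ S}`. -/
def deltaS (S A : Type*) : SRel S A := ⟨1, fun _ => { a | a 0 = a 1 }⟩

/-- Componentwise cyclic shift of coordinates. -/
def cycRel (ρ : SRel S A) : SRel S A :=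
  ⟨ρ.m, fun s => { b | (fun i => b (i - 1)) ∈ ρ.rel s }⟩

/-- Componentwise transposition of the first two coordinates. -/
def swapRel (ρ : SRel S A) : SRel S A :=
  ⟨ρ.m, fun s => { b | (fun i => b (Equiv.swap 0 1 i)) ∈ ρ.rel s }⟩

/-- Componentwise deletion of the first coordinate (identity on unary relations). -/
def prRel (ρ : SRel S A) : SRel S A :=
  match ρ with
  | ⟨0, r⟩ => ⟨0, r⟩
  | ⟨m + 1, r⟩ => ⟨m, fun s => { b | ∃ a ∈ r s, b = fun j => a j.succ }⟩

/-- Componentwise Cartesian product. -/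
def prodRel (ρ ρ' : SRel S A) : SRel S A :=
  ⟨ρ.m + ρ'.m + 1, fun s =>
    { c | (fun i : Fin (ρ.m + 1) => c ⟨i.val, by have := i.isLt; omega⟩) ∈ ρ.rel s ∧
          (fun i : Fin (ρ'.m + 1) => c ⟨ρ.m + 1 + i.val, by have := i.isLt; omega⟩) ∈ ρ'.rel s }⟩

/-- Componentwise intersection; empty if the arities differ. -/
def interRel (ρ ρ' : SRel S A) : SRel S A :=
  if h : ρ.m = ρ'.m then
    ⟨ρ.m, fun s => { a | a ∈ ρ.rel s ∧
        (fun i : Fin (ρ'.m + 1) => a (Fin.cast (by omega) i)) ∈ ρ'.rel s }⟩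
  else ⟨ρ.m, fun _ => ∅⟩

/-- Index translation `μ_v(ρ) := (ρ_{sv})_{s ∈ S}`. -/
def muRel (v : S) (ρ : SRel S A) : SRel S A := ⟨ρ.m, fun s => ρ.rel (s * v)⟩

/-- `v`-self-intersection `(⊓^v ρ)_s := ⋂ { ρ_{s'} ∣ s'v = s }`
(an empty intersection being the full relation). -/
def selfInterRel (v : S) (ρ : SRel S A) : SRel S A :=
  ⟨ρ.m, fun s => { a | ∀ s' : S, s' * v = s → a ∈ ρ.rel s' }⟩

/-- A set of `S`-relations is an `S`-relational clone if it contains `δ^S` and is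
closed under `ζ`, `τ`, `pr`, `×`, `∧`, `μ_v` and `⊓^v`. -/
def IsSRelClone (Q : Set (SRel S A)) : Prop :=
  deltaS S A ∈ Q ∧
  (∀ ρ ∈ Q, cycRel ρ ∈ Q) ∧
  (∀ ρ ∈ Q, swapRel ρ ∈ Q) ∧
  (∀ ρ ∈ Q, prRel ρ ∈ Q) ∧
  (∀ ρ ∈ Q, ∀ ρ' ∈ Q, prodRel ρ ρ' ∈ Q) ∧
  (∀ ρ ∈ Q, ∀ ρ' ∈ Q, interRel ρ ρ' ∈ Q) ∧
  (∀ (v : S), ∀ ρ ∈ Q, muRel v ρ ∈ Q) ∧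
  (∀ (v : S), ∀ ρ ∈ Q, selfInterRel v ρ ∈ Q)

/-- The `S`-relational clone generated by `Q`. -/
def SRg (Q : Set (SRel S A)) : Set (SRel S A) := ⋂₀ { R | IsSRelClone R ∧ Q ⊆ R }

/-- `Γ_F(ρ)`: the least `S`-relation of the same arity containing `ρ` and invariant
for `F` (defined as the intersection of all such). -/
def Gamma (F : Set (SOp S A)) (ρ : SRel S A) : SRel S A :=
  ⟨ρ.m, fun s => ⋂ g ∈ { g : S → Set (Fin (ρ.m + 1) → A) |
      (⟨ρ.m, g⟩ : SRel S A) ∈ SInv F ∧ ∀ t, ρ.rel t ⊆ g t }, g s⟩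

/-- Trivial `S`-operations (trivial projections): projections whose essential
argument has signum `e`. -/
def SJ (S A : Type*) [Monoid S] : Set (SOp S A) :=
  { f | ∃ i : Fin (f.n + 1), f.sgn i = 1 ∧ ∀ x, f.fn x = x i }

/-- A diagonal relation: empty, or defined by an equivalence relation on the coordinates. -/
def IsDiagonal {A : Type*} {m : ℕ} (σ : Set (Fin m → A)) : Prop :=
  σ = ∅ ∨ ∃ ε : Fin m → Fin m → Prop, Equivalence ε ∧ σ = { a | ∀ i j, ε i j → a i = a j }

/-- `S`-diagonal `S`-relations. -/
def SD (S A : Type*) [Monoid S] : Set (SRel S A) :=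
  { ρ | (∀ s, IsDiagonal (ρ.rel s)) ∧
      ∀ s t : S, ({ x | ∃ u, x = u * s } : Set S) ⊆ { x | ∃ u, x = u * t } →
        ρ.rel s ⊆ ρ.rel t }

/-- Projection of an `S`-relation to the rows `z 0, …, z t` (componentwise). -/
def prMulti {t : ℕ} (ρ : SRel S A) (z : Fin (t + 1) → Fin (ρ.m + 1)) : SRel S A :=
  ⟨t, fun s => { b | ∃ a ∈ ρ.rel s, b = fun j => a (z j) }⟩

/-- One step of the inductive construction of `Γ_F(ρ)`:
`R s ∪ { f(r₁,…,r_n) ∣ f ∈ F, r_j ∈ R (sgn(f)_j * s) }`. -/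
def gammaStep (F : Set (SOp S A)) {m : ℕ}
    (R : S → Set (Fin (m + 1) → A)) : S → Set (Fin (m + 1) → A) :=
  fun s => R s ∪ { b | ∃ f ∈ F, ∃ r : Fin (f.n + 1) → (Fin (m + 1) → A),
    (∀ j, r j ∈ R (f.sgn j * s)) ∧ b = fun z => f.fn fun j => r j z }

/-- `χ` is (a presentation of) the `S`-relation `χ^λ`: its rows are enumerated by
*all* tuples of `A^n` via `e`, and its `s`-component consists exactly of the columns
`κ_i` with `λ i = s`. -/
def IsChi {n : ℕ} (lam : Fin n → S) (χ : SRel S A) : Prop :=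
  ∃ e : Fin (χ.m + 1) ≃ (Fin n → A),
    ∀ s, χ.rel s = { c | ∃ i, lam i = s ∧ c = fun z => e z i }

/-- `γ_Q(ρ)`: the least `S`-relation of the same arity containing `ρ` and belonging
to the `S`-relational clone generated by `Q` (defined as the intersection of all such). -/
def gammaQ (Q : Set (SRel S A)) (ρ : SRel S A) : SRel S A :=
  ⟨ρ.m, fun s => ⋂ g ∈ { g : S → Set (Fin (ρ.m + 1) → A) |
      (⟨ρ.m, g⟩ : SRel S A) ∈ SRg Q ∧ ∀ t, ρ.rel t ⊆ g t }, g s⟩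

/-- `π`-dual of an `S`-operation. -/
def opPi (π : Equiv.Perm A) (f : SOp S A) : SOp S A :=
  ⟨f.n, fun x => π (f.fn fun i => π.symm (x i)), f.sgn⟩

/-- `π`-dual of an `S`-relation. -/
def relPi (π : Equiv.Perm A) (ρ : SRel S A) : SRel S A :=
  ⟨ρ.m, fun s => { b | ∃ a ∈ ρ.rel s, b = fun i => π (a i) }⟩

/-- `h`-dual of an `S`-operation (only the signum changes). -/
def opH (h : S ≃* S) (f : SOp S A) : SOp S A :=
  ⟨f.n, f.fn, fun i => h (f.sgn i)⟩

/-- `h`-dual of an `S`-relation: `ρ^h := (ρ_{h⁻¹(s)})_{s ∈ S}`. -/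
def relH (h : S ≃* S) (ρ : SRel S A) : SRel S A :=
  ⟨ρ.m, fun s => ρ.rel (h.symm s)⟩

end

/-- An ordinary (unsigned) operation on `A`. -/
structure UOp (A : Type*) where
  n : ℕ
  fn : (Fin (n + 1) → A) → A

/-- An ordinary (unsigned) relation on `A`. -/
structure URel (A : Type*) where
  m : ℕ
  rel : Set (Fin (m + 1) → A)

/-- Ordinary preservation of a relation by an operation. -/
def UPreserves {A : Type*} (f : UOp A) (σ : URel A) : Prop :=
  ∀ r : Fin (f.n + 1) → (Fin (σ.m + 1) → A),
    (∀ i, r i ∈ σ.rel) → (fun j => f.fn fun i => r i j) ∈ σ.rel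

/-- Polymorphisms of a set of ordinary relations. -/
def UPol {A : Type*} (R : Set (URel A)) : Set (UOp A) := { f | ∀ σ ∈ R, UPreserves f σ }

/-- A clone: contains all projections and is closed under composition. -/
def IsClone {A : Type*} (C : Set (UOp A)) : Prop :=
  (∀ (n : ℕ) (i : Fin (n + 1)), (⟨n, fun x => x i⟩ : UOp A) ∈ C) ∧
  (∀ f ∈ C, ∀ (m : ℕ) (g : Fin (f.n + 1) → ((Fin (m + 1) → A) → A)),
    (∀ i, (⟨m, g i⟩ : UOp A) ∈ C) → (⟨m, fun x => f.fn fun i => g i x⟩ : UOp A) ∈ C)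

/-- The clone generated by a set of operations. -/
def CloneGen {A : Type*} (G : Set (UOp A)) : Set (UOp A) := ⋂₀ { C | IsClone C ∧ G ⊆ C }

section

variable {S A : Type*} [Monoid S]

/-- `S`-preclones are closed under permutation of arguments. -/
theorem IsSPreclone.perm_mem {F : Set (SOp S A)} (hF : IsSPreclone F) {n : ℕ}
    (σ : Equiv.Perm (Fin (n + 1))) :
    ∀ (fn : (Fin (n + 1) → A) → A) (sgn : Fin (n + 1) → S), (⟨n, fn, sgn⟩ : SOp S A) ∈ F →
      (⟨n, fun x => fn (x ∘ σ), sgn ∘ σ.symm⟩ : SOp S A) ∈ F := by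
  obtain ⟨-, hcyc, hswap, -⟩ := hF
  rcases n with _ | n
  · intro fn sgn h
    have : Subsingleton (Fin (0 + 1)) := inferInstanceAs (Subsingleton (Fin 1))
    obtain rfl : σ = 1 := Subsingleton.elim _ _
    exact h
  have hσ : σ ∈ Submonoid.closure
      ({finRotate (n + 2), Equiv.swap 0 (finRotate (n + 2) 0)} :
        Set (Equiv.Perm (Fin (n + 2)))) := by
    rw [← Subgroup.closure_toSubmonoid_of_finite,
      Equiv.Perm.closure_cycle_adjacent_swap isCycle_finRotate support_finRotate]
    trivial
  induction hσ using Submonoid.closure_induction with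
  | mem σ hσ =>
    intro fn sgn h
    rcases hσ with rfl | rfl
    · convert hcyc _ h using 1
      simp only [cycOp, SOp.mk.injEq, heq_eq_eq, true_and]
      constructor
      · funext x
        congr 1
        funext j
        simp
      · funext i
        simp [finRotate_symm_apply]
    · convert hswap _ h using 1
      simp only [swapOp, SOp.mk.injEq, heq_eq_eq, true_and]
      constructor
      · funext x
        congr 1
      · funext i
        simp
  | one => exact fun fn sgn h => h
  | mul σ τ _ _ hσ hτ => exact fun fn sgn h => hσ _ _ (hτ _ _ h)

/-- Minors along surjections: arguments with equal signum are permuted and identified. -/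
theorem IsSPreclone.minor_mem_of_surjective {F : Set (SOp S A)} (hF : IsSPreclone F) {m : ℕ}
    (lam : Fin (m + 1) → S) (n : ℕ) :
    ∀ (fn : (Fin (n + 1) → A) → A) (sgn : Fin (n + 1) → S) (σ : Fin (n + 1) → Fin (m + 1)),
      Function.Surjective σ → (∀ i, sgn i = lam (σ i)) → (⟨n, fn, sgn⟩ : SOp S A) ∈ F →
      (⟨m, fun x => fn (x ∘ σ), lam⟩ : SOp S A) ∈ F := by
  induction n with
  | zero =>
    intro fn sgn σ hσ hs h
    obtain rfl : m = 0 := by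
      have := Fintype.card_le_of_surjective σ hσ
      simp at this
      omega
    have : Subsingleton (Fin (0 + 1)) := inferInstanceAs (Subsingleton (Fin 1))
    obtain rfl : σ = id := Subsingleton.elim _ _
    obtain rfl : sgn = lam := funext hs
    exact h
  | succ n ih =>
    intro fn sgn σ hσ hs h
    by_cases hinj : Function.Injective σ
    · obtain rfl : m = n + 1 := by
        have := Fintype.card_of_bijective ⟨hinj, hσ⟩
        simp at this
        omega
      have hlam : lam = sgn ∘ (Equiv.ofBijective σ ⟨hinj, hσ⟩).symm := funext fun i =>
        ((hs _).trans (congrArg lam (Equiv.ofBijective_apply_symm_apply σ ⟨hinj, hσ⟩ i))).symm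
      rw [hlam]
      exact hF.perm_mem (Equiv.ofBijective σ ⟨hinj, hσ⟩) fn sgn h
    · obtain ⟨i, j, hij, hne⟩ : ∃ i j, σ i = σ j ∧ i ≠ j := by
        simpa [Function.Injective] using hinj
      obtain ⟨π, hπi, hπj⟩ : ∃ π : Equiv.Perm (Fin (n + 2)), π.symm 0 = i ∧ π.symm 1 = j := by
        refine ⟨((Equiv.swap 0 i).trans (Equiv.swap 1 (Equiv.swap 0 i j))), ?_, ?_⟩
        · have h0 : (0 : Fin (n + 2)) ≠ Equiv.swap 0 i j := by
            intro h0
            have := congrArg (Equiv.swap 0 i) h0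
            simp at this
            exact hne this
          simp [Equiv.swap_apply_of_ne_of_ne (a := (1 : Fin (n + 2))) Fin.zero_ne_one h0]
        · simp
      have h01 : σ (π.symm 0) = σ (π.symm 1) := by rw [hπi, hπj, hij]
      have hδ := hF.2.2.2.2.1 _ (hF.perm_mem π fn sgn h)
      have hsgn : (sgn ∘ π.symm) 0 = (sgn ∘ π.symm) 1 := by simp [hs, h01]
      simp only [deltaOp, if_pos hsgn] at hδ
      have key : ∀ k : Fin (n + 2),
          σ (π.symm (Fin.succ ⟨(k : ℕ) - 1, by have := k.isLt; omega⟩)) = σ (π.symm k) := by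
        intro k
        refine Fin.cases ?_ (fun k => ?_) k
        · exact h01.symm
        · rfl
      have := ih _ _ (fun k => σ (π.symm k.succ)) ?_ ?_ hδ
      · convert this using 2
        funext x
        congr 1
        funext k
        simp only [Function.comp_apply, key, Equiv.symm_apply_apply]
      · intro b
        obtain ⟨a, rfl⟩ := hσ b
        refine ⟨⟨(π a : ℕ) - 1, by have := (π a).isLt; omega⟩, ?_⟩
        simp only [key, Equiv.symm_apply_apply]
      · intro k
        simp [hs]

/-- `S`-preclones are closed under arbitrary minors respecting the signa. -/
theorem IsSPreclone.minor_mem {F : Set (SOp S A)} (hF : IsSPreclone F) {m n : ℕ}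
    {fn : (Fin (n + 1) → A) → A} {sgn : Fin (n + 1) → S} (lam : Fin (m + 1) → S)
    (σ : Fin (n + 1) → Fin (m + 1)) (hs : ∀ i, sgn i = lam (σ i))
    (h : (⟨n, fn, sgn⟩ : SOp S A) ∈ F) :
    (⟨m, fun x => fn (x ∘ σ), lam⟩ : SOp S A) ∈ F := by
  classical
  obtain ⟨k, hk⟩ : ∃ k, (Finset.univ.image σ)ᶜ.card = k := ⟨_, rfl⟩
  induction k using Nat.strong_induction_on generalizing n with
  | _ k ih =>
    by_cases hσ : Function.Surjective σ
    · exact hF.minor_mem_of_surjective lam n fn sgn σ hσ hs h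
    · obtain ⟨j, hj⟩ : ∃ j, ∀ i, σ i ≠ j := by simpa [Function.Surjective] using hσ
      refine ih _ ?_ (Fin.cons j σ : Fin (n + 2) → Fin (m + 1)) ?_ (hF.2.2.2.1 (lam j) _ h) rfl
      · rw [← hk]
        apply Finset.card_lt_card
        rw [Finset.compl_ssubset_compl]
        refine (Finset.ssubset_iff_of_subset ?_).2 ⟨j, ?_, ?_⟩
        · intro b hb
          obtain ⟨i, -, rfl⟩ := Finset.mem_image.1 hb
          exact Finset.mem_image.2 ⟨i.succ, Finset.mem_univ _, rfl⟩
        · exact Finset.mem_image.2 ⟨0, Finset.mem_univ _, rfl⟩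
        · simpa using hj
      · intro i
        refine Fin.cases rfl (fun i => ?_) i
        exact hs i

/-- Substitution of an operation for a first argument of signum `e`, reusing the variables. -/
theorem IsSPreclone.subst_mem {F : Set (SOp S A)} (hF : IsSPreclone F) {m : ℕ}
    {lam : Fin (m + 1) → S} {fn : (Fin (m + 2) → A) → A} {g : (Fin (m + 1) → A) → A}
    (hf : (⟨m + 1, fn, Fin.cons 1 lam⟩ : SOp S A) ∈ F) (hg : (⟨m, g, lam⟩ : SOp S A) ∈ F) :
    (⟨m, fun x => fn (Fin.cons (g x) x), lam⟩ : SOp S A) ∈ F := by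
  have hc := hF.2.2.2.2.2 _ hf _ hg
  let σ : Fin (m + (m + 1) + 1) → Fin (m + 1) := fun i =>
    if h : i.val < m + 1 then ⟨i.val, h⟩ else ⟨i.val - (m + 1), by have := i.isLt; omega⟩
  have := hF.minor_mem (m := m) lam σ ?_ hc
  · convert this using 2
    funext x
    congr 1
    funext k
    refine Fin.cases ?_ (fun k => ?_) k
    · refine congrArg g (funext fun i => congrArg x ?_)
      simp only [σ, dif_pos i.isLt]
    · refine congrArg x ?_
      have hk : ¬ m + 1 + (k : ℕ) < m + 1 := by omega
      simp only [σ, dif_neg hk, Nat.add_sub_cancel_left]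
  · intro i
    by_cases h : i.val < m + 1
    · simp only [σ, dif_pos h, Fin.cons_zero, mul_one]
    · have : (⟨i.val - m, by have := i.isLt; omega⟩ : Fin (m + 2)) =
          Fin.succ ⟨i.val - (m + 1), by have := i.isLt; omega⟩ := by
        ext
        simp
        omega
      simp only [σ, dif_neg h, this, Fin.cons_succ]

/-- The least `S`-preclone consists of trivial operations. -/
theorem IsSPreclone.SJ_subset {F : Set (SOp S A)} (hF : IsSPreclone F) : SJ S A ⊆ F := by
  rintro ⟨n, fn, sgn⟩ ⟨i, hi, hfn⟩
  simp only at i hi hfn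
  obtain rfl : fn = fun x => x i := funext hfn
  exact hF.minor_mem sgn (fun _ => i) (fun _ => hi.symm) hF.1

theorem isSPreclone_SSg (X : Set (SOp S A)) : IsSPreclone (SSg X) :=
  ⟨fun G hG => hG.1.1, fun f hf G hG => hG.1.2.1 f (hf G hG),
    fun f hf G hG => hG.1.2.2.1 f (hf G hG), fun s f hf G hG => hG.1.2.2.2.1 s f (hf G hG),
    fun f hf G hG => hG.1.2.2.2.2.1 f (hf G hG),
    fun f hf g hg G hG => hG.1.2.2.2.2.2 f (hf G hG) g (hg G hG)⟩

theorem isSPreclone_sUnion {c : Set (Set (SOp S A))} (hc : IsChain (· ⊆ ·) c)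
    (hne : c.Nonempty) (h : ∀ G ∈ c, IsSPreclone G) : IsSPreclone (⋃₀ c) := by
  obtain ⟨G₀, hG₀⟩ := hne
  refine ⟨⟨G₀, hG₀, (h _ hG₀).1⟩, ?_, ?_, ?_, ?_, ?_⟩
  · rintro f ⟨G, hG, hf⟩
    exact ⟨G, hG, (h G hG).2.1 f hf⟩
  · rintro f ⟨G, hG, hf⟩
    exact ⟨G, hG, (h G hG).2.2.1 f hf⟩
  · rintro s f ⟨G, hG, hf⟩
    exact ⟨G, hG, (h G hG).2.2.2.1 s f hf⟩
  · rintro f ⟨G, hG, hf⟩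
    exact ⟨G, hG, (h G hG).2.2.2.2.1 f hf⟩
  · rintro f ⟨G, hG, hf⟩ g ⟨G', hG', hg⟩
    rcases hc.total hG hG' with hle | hle
    · exact ⟨G', hG', (h G' hG').2.2.2.2.2 f (hle hf) g hg⟩
    · exact ⟨G, hG, (h G hG).2.2.2.2.2 f hf g (hle hg)⟩

theorem finite_setOf_n_eq {S A : Type*} [Finite S] [Finite A] (N : ℕ) : {f : SOp S A | f.n = N}.Finite := by
  refine (Set.finite_range fun p : ((Fin (N + 1) → A) → A) × (Fin (N + 1) → S) =>
    (⟨N, p.1, p.2⟩ : SOp S A)).subset ?_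
  rintro ⟨n, fn, sgn⟩ rfl
  exact ⟨(fn, sgn), rfl⟩

/-- An `S`-preclone containing all ternary operations contains every operation. -/
theorem IsSPreclone.eq_univ_of_ternary [Finite A] [Nonempty A] {F : Set (SOp S A)} (hF : IsSPreclone F)
    (h : {f : SOp S A | f.n = 2} ⊆ F) : F = Set.univ := by
  classical
  cases nonempty_fintype A
  refine Set.eq_univ_of_forall ?_
  rintro ⟨m, fn, lam⟩
  have hconst : ∀ a : A, (⟨m, fun _ => a, lam⟩ : SOp S A) ∈ F := fun a =>
    hF.minor_mem (n := 2) (fn := fun _ => a) (sgn := fun _ => lam 0) lam (fun _ => 0)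
      (fun _ => rfl) (h rfl)
  have hite : ∀ (a : A) (i : Fin (m + 1)) (u v : (Fin (m + 1) → A) → A),
      (⟨m, u, lam⟩ : SOp S A) ∈ F → (⟨m, v, lam⟩ : SOp S A) ∈ F →
      (⟨m, fun x => if x i = a then u x else v x, lam⟩ : SOp S A) ∈ F := by
    intro a i u v hu hv
    have h₀ : (⟨2, fun x => if x 0 = a then x 1 else x 2, ![lam i, 1, 1]⟩ : SOp S A) ∈ F := h rfl
    have h₁ := hF.minor_mem (m := m + 2) (Fin.cons 1 (Fin.cons 1 lam))
      ![i.succ.succ, 0, 1] (by intro j; fin_cases j <;> rfl) h₀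
    have hu' := hF.minor_mem (m := m + 1) (Fin.cons 1 lam) Fin.succ (fun _ => rfl) hu
    exact hF.subst_mem (hF.subst_mem h₁ hu') hv
  suffices H : ∀ (T : Finset (Fin (m + 1))) (g : (Fin (m + 1) → A) → A),
      (∀ x y, (∀ i ∈ T, x i = y i) → g x = g y) → (⟨m, g, lam⟩ : SOp S A) ∈ F from
    H Finset.univ fn fun x y hxy => congrArg fn (funext fun i => hxy i (Finset.mem_univ i))
  intro T
  induction T using Finset.induction_on with
  | empty =>
    intro g hg
    convert hconst (g fun _ => Classical.arbitrary A) using 2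
    funext x
    exact hg _ _ (by simp)
  | insert i T hi ih =>
    intro g hg
    have hupd : ∀ a, (⟨m, fun x => g (Function.update x i a), lam⟩ : SOp S A) ∈ F := by
      intro a
      refine ih _ fun x y hxy => hg _ _ fun j hj => ?_
      by_cases hji : j = i
      · subst hji
        simp
      · simp [hji, hxy j (Finset.mem_of_mem_insert_of_ne hj hji)]
    have hfin : ∀ B : Finset A, (⟨m, fun x => if x i ∈ B then g x else
        g (Function.update x i (Classical.arbitrary A)), lam⟩ : SOp S A) ∈ F := by
      intro B
      induction B using Finset.induction_on with
      | empty => simpa using hupd _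
      | insert b B _ ihB =>
        convert hite b i _ _ (hupd b) ihB using 2
        funext x
        by_cases hxb : x i = b
        · subst hxb
          simp
        · simp [hxb]
    simpa using hfin Finset.univ

/-- Three-wise intersecting agreement with coordinates forces a projection. -/
theorem eq_proj_of_three [Nontrivial A] {n : ℕ} {f : (Fin n → A) → A} {P : Fin n → Prop}
    (h : ∀ x y z : Fin n → A, ∃ i, P i ∧ f x = x i ∧ f y = y i ∧ f z = z i) :
    ∃ i, P i ∧ ∀ x, f x = x i := by
  classical
  obtain ⟨a, b, hab⟩ := exists_pair_ne A
  let ind : Finset (Fin n) → Fin n → A := fun B i => if i ∈ B then a else b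
  obtain ⟨U, hU, hmin⟩ : ∃ U : Finset (Fin n), f (ind U) = a ∧
      ∀ V, V ⊂ U → f (ind V) = b := by
    have hex : ∃ U, f (ind U) = a := by
      obtain ⟨i, -, hi, -⟩ := h (ind Finset.univ) (ind Finset.univ) (ind Finset.univ)
      exact ⟨Finset.univ, by simpa [ind] using hi⟩
    obtain ⟨U, hU⟩ := exists_minimal_of_wellFoundedLT (fun U => f (ind U) = a) hex
    refine ⟨U, hU.prop, fun V hV => ?_⟩
    obtain ⟨i, -, hi, -⟩ := h (ind V) (ind V) (ind V)
    by_cases hiV : i ∈ V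
    · exact absurd (hi.trans (if_pos hiV)) (hU.not_prop_of_lt hV)
    · exact hi.trans (if_neg hiV)
  have mem_U : ∀ i, f (ind U) = ind U i → i ∈ U := by
    intro i hi
    by_contra hiU
    exact hab (hU.symm.trans (hi.trans (if_neg hiU)))
  obtain ⟨i, -, hi, -⟩ := h (ind U) (ind U) (ind U)
  have hiU := mem_U i hi
  have key : ∀ j, j ∈ U → j = i := by
    by_contra! hj
    obtain ⟨j, hjU, hji⟩ := hj
    have h₁ := hmin {i} (Finset.ssubset_iff_of_subset (by simpa using hiU) |>.2
      ⟨j, hjU, by simpa using hji⟩)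
    have h₂ := hmin (U.erase i) (Finset.erase_ssubset hiU)
    obtain ⟨k, -, hk, hk₁, hk₂⟩ := h (ind U) (ind {i}) (ind (U.erase i))
    have hkU := mem_U k hk
    by_cases hki : k = i
    · exact hab ((h₁.symm.trans (hk₁.trans (if_pos (by simpa using hki)))).symm)
    · exact hab ((h₂.symm.trans (hk₂.trans (if_pos (by simp [hki, hkU])))).symm)
  obtain ⟨k, hk, hkU, -⟩ := h (ind U) (ind U) (ind U)
  obtain rfl := key k (mem_U k hkU)
  refine ⟨k, hk, fun x => ?_⟩
  obtain ⟨j, -, hj, hjx, -⟩ := h (ind U) x x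
  rwa [key j (mem_U j hj)] at hjx

/-- Every `S`-preclone not consisting of trivial operations contains a nontrivial operation
of one fixed arity. -/
theorem IsSPreclone.exists_bounded_nontrivial [Fintype S] [Fintype A] [Nontrivial A]
    {F : Set (SOp S A)} (hF : IsSPreclone F) (h : ¬ F ⊆ SJ S A) :
    ∃ f ∈ F, f.n = Fintype.card (S × A × A × A) - 1 ∧ f ∉ SJ S A := by
  classical
  by_contra! hcon
  refine h ?_
  rintro ⟨n, fn, sgn⟩ hf
  refine eq_proj_of_three (P := fun i => sgn i = 1) fun x y z => ?_
  have hcard : Fintype.card (S × A × A × A) - 1 + 1 = Fintype.card (S × A × A × A) :=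
    Nat.succ_pred_eq_of_pos Fintype.card_pos
  let e : S × A × A × A ≃ Fin (Fintype.card (S × A × A × A) - 1 + 1) :=
    Fintype.equivFinOfCardEq hcard.symm
  let σ := fun i : Fin (n + 1) => e (sgn i, x i, y i, z i)
  obtain ⟨k, hk, hproj⟩ := hcon _ (hF.minor_mem (fun k => (e.symm k).1) σ
    (fun i => by simp [σ]) hf) rfl
  simp only at hk hproj
  obtain ⟨i, rfl⟩ : ∃ i, σ i = k := by
    by_contra! hne
    obtain ⟨a, b, hab⟩ := exists_pair_ne A
    refine hab ?_
    have h₁ := hproj fun _ => a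
    have h₂ := hproj (Function.update (fun _ => a) k b)
    have : Function.update (fun _ => a) k b ∘ σ = (fun _ => a) ∘ σ := by
      funext i
      simp [hne i]
    rw [this, h₁] at h₂
    simpa using h₂
  refine ⟨i, by simpa [σ] using hk, ?_, ?_, ?_⟩
  · simpa [σ, Function.comp_def] using hproj fun k => (e.symm k).2.1
  · simpa [σ, Function.comp_def] using hproj fun k => (e.symm k).2.2.1
  · simpa [σ, Function.comp_def] using hproj fun k => (e.symm k).2.2.2

end

/-- The lattice of `S`-preclones on a finite set `A` with at least two elements is
atomic and coatomic: every `S`-preclone strictly above `SJ_A` contains a minimal one,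
and every `S`-preclone strictly below `SOp(A)` is contained in a maximal one. -/
theorem SPreclone_lattice_atomic_coatomic {S A : Type*} [Monoid S] [Fintype S]
    [Fintype A] [Nontrivial A] :
    (∀ F : Set (SOp S A), IsSPreclone F → SJ S A ⊂ F →
      ∃ M, IsSPreclone M ∧ SJ S A ⊂ M ∧ M ⊆ F ∧
        ∀ G, IsSPreclone G → SJ S A ⊂ G → G ⊆ M → G = M) ∧
    (∀ F : Set (SOp S A), IsSPreclone F → F ⊂ Set.univ →
      ∃ M, IsSPreclone M ∧ M ⊂ Set.univ ∧ F ⊆ M ∧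
        ∀ G, IsSPreclone G → G ⊂ Set.univ → M ⊆ G → G = M) := by
  constructor
  · intro F hF hSJ
    let X : Set (SOp S A) := {f | f.n = Fintype.card (S × A × A × A) - 1 ∧ f ∉ SJ S A}
    have hX : X.Finite := (finite_setOf_n_eq _).subset fun f hf => hf.1
    have hne : ∀ G : Set (SOp S A), IsSPreclone G → SJ S A ⊂ G → (G ∩ X).Nonempty := by
      intro G hG hlt
      obtain ⟨f, hf, hfX⟩ := hG.exists_bounded_nontrivial hlt.not_subset
      exact ⟨f, hf, hfX⟩
    let 𝒴 : Set (Set (SOp S A)) :=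
      {Y | ∃ G, IsSPreclone G ∧ SJ S A ⊂ G ∧ G ⊆ F ∧ Y = G ∩ X}
    have h𝒴 : 𝒴.Finite := hX.finite_subsets.subset (by
      rintro _ ⟨G, -, -, -, rfl⟩
      exact Set.inter_subset_right)
    obtain ⟨Y, hY⟩ := h𝒴.exists_minimal ⟨_, F, hF, hSJ, subset_rfl, rfl⟩
    obtain ⟨G, hG, hGSJ, hGF, rfl⟩ := hY.prop
    have hle : ∀ H, IsSPreclone H → G ∩ X ⊆ H → SSg (G ∩ X) ⊆ H :=
      fun H hH hsub => Set.sInter_subset_of_mem ⟨hH, hsub⟩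
    refine ⟨SSg (G ∩ X), isSPreclone_SSg _, ?_, (hle G hG Set.inter_subset_left).trans hGF, ?_⟩
    · obtain ⟨f, hf⟩ := hne G hG hGSJ
      exact (Set.ssubset_iff_of_subset (isSPreclone_SSg _).SJ_subset).2
        ⟨f, fun H hH => hH.2 hf, hf.2.2⟩
    · intro H hH hHSJ hHM
      have hHG := hHM.trans (hle G hG Set.inter_subset_left)
      refine hHM.antisymm (hle H hH ?_)
      exact (hY.le_of_le ⟨H, hH, hHSJ, hHG.trans hGF, rfl⟩
        (Set.inter_subset_inter_left _ hHG)).trans Set.inter_subset_left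
  · intro F hF hlt
    obtain ⟨M, hFM, hM⟩ := zorn_subset_nonempty
      {G : Set (SOp S A) | IsSPreclone G ∧ G ≠ Set.univ} (by
        intro c hc hchain hne
        refine ⟨⋃₀ c, ⟨isSPreclone_sUnion hchain hne fun G hG => (hc hG).1, fun huniv => ?_⟩,
          fun s hs => Set.subset_sUnion_of_mem hs⟩
        obtain ⟨G, hG, hsub⟩ := hchain.directedOn.exists_mem_subset_of_finite_of_subset_sUnion
          hne (finite_setOf_n_eq (S := S) (A := A) 2) (huniv ▸ Set.subset_univ _)
        exact (hc hG).2 ((hc hG).1.eq_univ_of_ternary hsub)) F ⟨hF, hlt.ne⟩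
    refine ⟨M, hM.prop.1, Set.ssubset_univ_iff.2 hM.prop.2, hFM, fun G hG hGu hMG => ?_⟩
    exact (hM.le_of_ge ⟨hG, hGu.ne⟩ hMG).antisymm hMG

end SPreclone
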